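/- Let A and B be groups and let x, y, z be nontrivial elements of the free product A * B such that xy = yx and xz = zx. If x is not elliptic (i.e. x is not conjugate to an element of the canonical image of A or of the canonical image of B), then y and z are not elliptic either, and yz = zy. -/

import Mathlib

/-- An element of the free product `A ∗ B` is *elliptic* if it is conjugate to an element of
the canonical image of `A` or of the canonical image of `B`. -/
def IsElliptic {A B : Type*} [Group A] [Group B] (x : Monoid.Coprod A B) : Prop :=
  ∃ c : Monoid.Coprod A B,
    (∃ a : A, x = c * Monoid.Coprod.inl a * c⁻¹) ∨ (∃ b : B, x = c * Monoid.Coprod.inr b * c⁻¹)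

namespace List

variable {α : Type*}

theorem flatten_replicate_append_comm {u p : List α} (h : u ++ p = p ++ u) (n : ℕ) :
    (replicate n u).flatten ++ p = p ++ (replicate n u).flatten := by
  induction n with
  | zero => simp
  | succ n ih => rw [replicate_succ, flatten_cons, append_assoc, ih, ← append_assoc, h, append_assoc]

/-- Two words of the same length that commute with a common nonempty word are equal. -/
theorem eq_of_append_comm_of_length_eq {u p q : List α} (hu : u ≠ []) (hp : u ++ p = p ++ u)
    (hq : u ++ q = q ++ u) (hpq : p.length = q.length) : p = q := by
  have hlen : p.length ≤ (replicate p.length u).flatten.length := by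
    have := length_pos_iff.2 hu
    simp only [length_flatten, map_replicate, sum_replicate, smul_eq_mul]
    exact Nat.le_mul_of_pos_right _ this
  have key : ∀ r : List α, u ++ r = r ++ u → r.length = p.length →
      r = (replicate p.length u).flatten.take p.length := fun r hr hrp => by
    have h := congrArg (take p.length) (flatten_replicate_append_comm hr p.length)
    rw [take_append_of_le_length hlen, take_append_of_le_length hrp.ge, ← hrp, take_length] at h
    rw [← hrp, h]
  rw [key p hp rfl, ← key q hq hpq.symm]

/-- Words that commute with a common nonempty word commute with each other. -/
theorem append_comm_of_append_comm {u v w : List α} (hu : u ≠ []) (hv : u ++ v = v ++ u)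
    (hw : u ++ w = w ++ u) : v ++ w = w ++ v := by
  refine eq_of_append_comm_of_length_eq hu ?_ ?_ (by simp [Nat.add_comm])
  · rw [← append_assoc, hv, append_assoc, hw, append_assoc]
  · rw [← append_assoc, hw, append_assoc, hv, append_assoc]

end List

namespace Monoid.CoprodI

variable {ι : Type*}

namespace NeWord

section Monoid

variable {M : ι → Type*} [∀ i, Monoid (M i)]

theorem exists_prod_eq {g : CoprodI M} (hg : g ≠ 1) :
    ∃ (i j : ι) (w : NeWord M i j), w.prod = g := by
  classical
  obtain ⟨i, j, w, hw⟩ := of_word (Word.equiv g) fun h => hg <| by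
    rw [← Word.equiv.symm_apply_apply g, h]
    exact Word.prod_empty
  exact ⟨i, j, w, by rw [prod, hw]; exact Word.equiv.symm_apply_apply g⟩

theorem toList_eq_of_prod_eq {i j k l : ι} {w : NeWord M i j} {w' : NeWord M k l}
    (h : w.prod = w'.prod) : w.toList = w'.toList := by
  classical
  exact congrArg Word.toList (Word.equiv.symm.injective h)

theorem prod_eq_of_toList_eq {i j k l : ι} {w : NeWord M i j} {w' : NeWord M k l}
    (h : w.toList = w'.toList) : w.prod = w'.prod :=
  congrArg Word.prod (Word.ext h : w.toWord = w'.toWord)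

theorem last_index_eq_of_prod_eq {i j k l : ι} {w : NeWord M i j} {w' : NeWord M k l}
    (h : w.prod = w'.prod) : j = l := by
  have h' := congrArg List.getLast? (toList_eq_of_prod_eq h)
  rw [toList_getLast?, toList_getLast?] at h'
  exact congrArg Sigma.fst (Option.some.inj h')

theorem length_toList_pos {i j : ι} (w : NeWord M i j) : 0 < w.toList.length :=
  List.length_pos_iff.2 w.toList_ne_nil

/-- A nonempty reduced word is a single letter or its first letter can be split off. -/
theorem exists_eq_cons {i j : ι} (w : NeWord M i j) :
    (i = j ∧ (∃ a : M i, w.prod = of a) ∧ w.toList.length = 1) ∨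
      ∃ (a : M i) (k : ι) (_ : i ≠ k) (w' : NeWord M k j),
        w.prod = of a * w'.prod ∧ w.toList.length = w'.toList.length + 1 := by
  induction w with
  | singleton x hx => exact .inl ⟨rfl, ⟨x, prod_singleton x hx⟩, rfl⟩
  | @append i j k l w₁ hne w₂ ih₁ _ =>
    right
    rcases ih₁ with ⟨rfl, ⟨a, ha⟩, hl⟩ | ⟨a, m, hm, w', hp, hl⟩
    · refine ⟨a, k, hne, w₂, by rw [append_prod, ha], ?_⟩
      simp only [toList, List.length_append]
      lia
    · refine ⟨a, m, hm, append w' hne w₂, by simp only [append_prod, hp, mul_assoc], ?_⟩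
      simp only [toList, List.length_append]
      lia

/-- A nonempty reduced word is a single letter or its last letter can be split off. -/
theorem exists_eq_concat {i j : ι} (w : NeWord M i j) :
    (i = j ∧ (∃ a : M j, w.prod = of a) ∧ w.toList.length = 1) ∨
      ∃ (a : M j) (k : ι) (_ : k ≠ j) (w' : NeWord M i k),
        w.prod = w'.prod * of a ∧ w.toList.length = w'.toList.length + 1 := by
  induction w with
  | singleton x hx => exact .inl ⟨rfl, ⟨x, prod_singleton x hx⟩, rfl⟩
  | @append i j k l w₁ hne w₂ _ ih₂ =>
    right
    rcases ih₂ with ⟨rfl, ⟨a, ha⟩, hl⟩ | ⟨a, m, hm, w', hp, hl⟩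
    · refine ⟨a, j, hne, w₁, by rw [append_prod, ha], ?_⟩
      simp only [toList, List.length_append]
      lia
    · refine ⟨a, m, hm, append w₁ hne w', by simp only [append_prod, hp, mul_assoc], ?_⟩
      simp only [toList, List.length_append]
      lia

end Monoid

section Group

variable {G : ι → Type*} [∀ i, Group (G i)]

/-- A word not starting in the factor `k` conjugates no nontrivial element of `G k` into itself. -/
theorem of_mul_prod_ne_prod_mul_of {i j k l : ι} (w : NeWord G i j) (hik : i ≠ k) {a : G k}
    {b : G l} (ha : a ≠ 1) (hb : b ≠ 1) : of a * w.prod ≠ w.prod * of b := fun h => by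
  have hp : (append (append w.inv hik (singleton a ha)) hik.symm w).prod =
      (singleton b hb).prod := by
    simp [mul_assoc, h]
  have hl := congrArg List.length (toList_eq_of_prod_eq hp)
  simp only [toList, List.length_append, List.length_singleton] at hl
  have := w.length_toList_pos
  lia

theorem exists_pow_mul_of_length_le {i j : ι} (u : NeWord G i j) (hij : i ≠ j) (n : ℕ) :
    ∀ {k l : ι} (w : NeWord G k l), w.toList.length ≤ n →
      ∃ (N : ℕ) (m : ι) (w' : NeWord G i m), w'.prod = u.prod ^ N * w.prod := by
  induction n with
  | zero => intro k l w hw; exact absurd hw w.length_toList_pos.not_ge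
  | succ n ih =>
    intro k l w hw
    by_cases hk : k = j
    · subst hk
      by_cases h1 : u.prod * w.prod = 1
      · exact ⟨2, k, u, by rw [pow_two, mul_assoc, h1, mul_one]⟩
      obtain ⟨p, q, v, hv⟩ := exists_prod_eq h1
      by_cases hp : p = k
      · subst hp
        have hwv : (append u.inv hij v).prod = w.prod := by simp [hv]
        have hl := congrArg List.length (toList_eq_of_prod_eq hwv)
        have := u.inv.length_toList_pos
        simp only [toList, List.length_append] at hl
        obtain ⟨N, m, w', hw'⟩ := ih v (by lia)
        exact ⟨N + 1, m, w', by rw [hw', hv, pow_succ, mul_assoc]⟩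
      · exact ⟨2, q, append u (Ne.symm hp) v, by rw [append_prod, hv, pow_two, mul_assoc]⟩
    · exact ⟨1, l, append u (Ne.symm hk) w, by rw [append_prod, pow_one]⟩

/-- Multiplying on the left by a large power of a cyclically reduced word `u` yields a reduced
word starting in the same factor as `u`. -/
theorem exists_forall_pow_mul {i j : ι} (u : NeWord G i j) (hij : i ≠ j) (g : CoprodI G) :
    ∃ N : ℕ, ∀ n ≥ N, ∃ (m : ι) (w : NeWord G i m), w.prod = u.prod ^ n * g := by
  have base : ∃ (N : ℕ) (m : ι) (w : NeWord G i m), w.prod = u.prod ^ N * g := by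
    by_cases hg : g = 1
    · exact ⟨1, j, u, by simp [hg]⟩
    · obtain ⟨k, l, w, rfl⟩ := exists_prod_eq hg
      exact exists_pow_mul_of_length_le u hij _ w le_rfl
  obtain ⟨N, m, w, hw⟩ := base
  refine ⟨N, fun n hn => ⟨m, ?_⟩⟩
  induction n, hn using Nat.le_induction with
  | base => exact ⟨w, hw⟩
  | succ n _ ih =>
    obtain ⟨v, hv⟩ := ih
    exact ⟨append u hij.symm v, by rw [append_prod, hv, pow_succ', mul_assoc]⟩

/-- If `g` commutes with a cyclically reduced word `u`, then multiplying `g` by a power of `u`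
yields a reduced word starting and ending in the same factors as `u`. -/
theorem exists_prod_eq_pow_mul {i j : ι} (u : NeWord G i j) (hij : i ≠ j) {g : CoprodI G}
    (hg : Commute u.prod g) : ∃ (n : ℕ) (w : NeWord G i j), w.prod = u.prod ^ n * g := by
  obtain ⟨N₁, h₁⟩ := exists_forall_pow_mul u hij g
  obtain ⟨N₂, h₂⟩ := exists_forall_pow_mul u.inv hij.symm g⁻¹
  obtain ⟨m, w, hw⟩ := h₁ (max N₁ N₂) (le_max_left _ _)
  obtain ⟨m', w', hw'⟩ := h₂ (max N₁ N₂) (le_max_right _ _)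
  have hww : w.prod = w'.inv.prod := by
    rw [hw, inv_prod, hw', inv_prod, mul_inv_rev, inv_inv, inv_pow, inv_inv]
    exact (hg.pow_left _).eq
  obtain rfl := last_index_eq_of_prod_eq hww
  exact ⟨_, w, hw⟩

theorem commute_of_commute_prod {i j : ι} (u : NeWord G i j) (hij : i ≠ j) {y z : CoprodI G}
    (hy : Commute u.prod y) (hz : Commute u.prod z) : Commute y z := by
  obtain ⟨m, v, hv⟩ := exists_prod_eq_pow_mul u hij hy
  obtain ⟨n, w, hw⟩ := exists_prod_eq_pow_mul u hij hz
  have toList_comm : ∀ v w : NeWord G i j, Commute v.prod w.prod →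
      v.toList ++ w.toList = w.toList ++ v.toList := fun v w h =>
    toList_eq_of_prod_eq (w := append v hij.symm w) (w' := append w hij.symm v)
      (by rw [append_prod, append_prod, h.eq])
  have huv : Commute u.prod v.prod := hv ▸ ((Commute.refl _).pow_right m).mul_right hy
  have huw : Commute u.prod w.prod := hw ▸ ((Commute.refl _).pow_right n).mul_right hz
  have hvw : v.prod * w.prod = w.prod * v.prod := by
    rw [← append_prod (hne := hij.symm), ← append_prod (hne := hij.symm)]
    exact prod_eq_of_toList_eq
      (List.append_comm_of_append_comm u.toList_ne_nil (toList_comm _ _ huv) (toList_comm _ _ huw))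
  have hvz : Commute v.prod z := by
    have h : z = (u.prod ^ n)⁻¹ * w.prod := by rw [hw, inv_mul_cancel_left]
    rw [h]
    exact (huv.symm.pow_right n).inv_right.mul_right hvw
  have h : y = (u.prod ^ m)⁻¹ * v.prod := by rw [hv, inv_mul_cancel_left]
  rw [h]
  exact (hz.pow_left m).inv_left.mul_left hvz

end Group

end NeWord

section Group

open NeWord

variable {G : ι → Type*} [∀ i, Group (G i)]

/-- The centralizer of a nontrivial element of a factor is contained in that factor. -/
theorem exists_eq_of_of_commute {k : ι} {a : G k} (ha : a ≠ 1) {g : CoprodI G}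
    (h : Commute (of a) g) : ∃ b : G k, g = of b := by
  by_cases hg : g = 1
  · exact ⟨1, by rw [hg, map_one]⟩
  obtain ⟨i, j, w, rfl⟩ := exists_prod_eq hg
  by_cases hik : i = k
  · subst hik
    rcases w.exists_eq_cons with ⟨-, hb, -⟩ | ⟨b, m, hm, w', hp, -⟩
    · exact hb
    · have hc : b⁻¹ * a * b ≠ 1 := fun hc => ha <| by
        rwa [mul_assoc, inv_mul_eq_one, eq_comm, mul_eq_right] at hc
      refine absurd ?_ (of_mul_prod_ne_prod_mul_of w' hm.symm hc ha)
      have h' := h.eq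
      rw [hp] at h'
      simp only [map_mul, map_inv, mul_assoc] at h' ⊢
      rw [h', inv_mul_cancel_left]
  · exact absurd h.eq (of_mul_prod_ne_prod_mul_of w hik ha ha)

/-- Every element of a free product is conjugate to an element of a factor or to a cyclically
reduced word. -/
theorem exists_conj_of_or_cyclicallyReduced (x : CoprodI G) :
    (∃ (c : CoprodI G) (k : ι) (a : G k), x = c * of a * c⁻¹) ∨ x = 1 ∨
      ∃ (c : CoprodI G) (i j : ι) (_ : i ≠ j) (u : NeWord G i j), x = c * u.prod * c⁻¹ := by
  by_cases hx : x = 1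
  · exact .inr (.inl hx)
  obtain ⟨i, j, w, rfl⟩ := exists_prod_eq hx
  clear hx
  induction hn : w.toList.length using Nat.strong_induction_on generalizing i j with
  | _ n ih =>
    by_cases hij : i = j
    · subst hij
      rcases w.exists_eq_cons with ⟨-, ⟨a, ha⟩, -⟩ | ⟨a, k, hk, w', hp, hl⟩
      · exact .inl ⟨1, i, a, by simp [ha]⟩
      rcases w'.exists_eq_concat with ⟨h, -⟩ | ⟨b, l, hli, w'', hp', hl'⟩
      · exact absurd h.symm hk
      by_cases hba : b * a = 1
      · have hw : w.prod = of a * w''.prod * (of a)⁻¹ := by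
          rw [hp, hp', eq_inv_of_mul_eq_one_left hba, map_inv, mul_assoc]
        rcases ih _ (by lia) k l w'' rfl with ⟨c, m, d, hd⟩ | h1 | ⟨c, m, m', hm, u, hu⟩
        · exact .inl ⟨of a * c, m, d, by rw [hw, hd]; group⟩
        · exact .inr (.inl (by rw [hw, h1]; group))
        · exact .inr (.inr ⟨of a * c, m, m', hm, u, by rw [hw, hu]; group⟩)
      · refine .inr (.inr ⟨of a, k, i, hk.symm, append w'' hli (singleton _ hba), ?_⟩)
        rw [hp, hp', append_prod, prod_singleton, map_mul]
        group
    · exact .inr (.inr ⟨1, i, j, hij, w, by simp⟩)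

/-- An element commuting with a nontrivial conjugate of an element of a factor is itself a
conjugate of an element of that factor. -/
theorem exists_eq_conj_of_of_commute {k : ι} {a : G k} {c x : CoprodI G}
    (hne : c * of a * c⁻¹ ≠ 1) (h : Commute x (c * of a * c⁻¹)) :
    ∃ b : G k, x = c * of b * c⁻¹ := by
  have ha : a ≠ 1 := fun ha => hne (by simp [ha])
  have h' : Commute (of a) (c⁻¹ * x * c) := by
    have h₂ := (Commute.conj_iff (c⁻¹)).2 h.symm
    simpa [mul_assoc] using h₂
  obtain ⟨b, hb⟩ := exists_eq_of_of_commute ha h'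
  exact ⟨b, by rw [← hb]; group⟩

/-- The centralizer of an element lying in no conjugate of a factor is commutative. -/
theorem commute_of_commute_of_forall_ne_conj {x y z : CoprodI G}
    (hx : ∀ (c : CoprodI G) (k : ι) (a : G k), x ≠ c * of a * c⁻¹) (hx1 : x ≠ 1)
    (hxy : Commute x y) (hxz : Commute x z) : Commute y z := by
  rcases exists_conj_of_or_cyclicallyReduced x with
    ⟨c, k, a, h⟩ | h | ⟨c, i, j, hij, u, rfl⟩
  · exact absurd h (hx c k a)
  · exact absurd h hx1
  · have conj : ∀ g, Commute (c * u.prod * c⁻¹) g → Commute u.prod (c⁻¹ * g * c) := fun g hg => by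
      have h₂ := (Commute.conj_iff (c⁻¹)).2 hg
      simpa [mul_assoc] using h₂
    have h := commute_of_commute_prod u hij (conj y hxy) (conj z hxz)
    have h₂ := (Commute.conj_iff c).2 h
    simpa [mul_assoc] using h₂

end Group

end Monoid.CoprodI

namespace Monoid.Coprod

universe u v

/-- The two factors of a binary free product as a family indexed by `Bool`. -/
def BoolFamily (A : Type u) (B : Type v) : Bool → Type (max u v)
  | true => ULift.{v} A
  | false => ULift.{u} B

variable {A : Type u} {B : Type v} [Group A] [Group B]

instance (i : Bool) : Group (BoolFamily A B i) :=
  match i with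
  | true => inferInstanceAs (Group (ULift.{v} A))
  | false => inferInstanceAs (Group (ULift.{u} B))

variable (A B) in
/-- The inclusion of the first factor into the indexed free product. -/
def inlBool : A →* CoprodI (BoolFamily A B) :=
  (CoprodI.of (M := BoolFamily A B) (i := true)).comp
    (MulEquiv.ulift.symm : A ≃* ULift.{v} A).toMonoidHom

variable (A B) in
/-- The inclusion of the second factor into the indexed free product. -/
def inrBool : B →* CoprodI (BoolFamily A B) :=
  (CoprodI.of (M := BoolFamily A B) (i := false)).comp
    (MulEquiv.ulift.symm : B ≃* ULift.{u} B).toMonoidHom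

variable (A B) in
/-- The canonical map of each member of the family into the binary free product. -/
def ofBool : (i : Bool) → BoolFamily A B i →* Coprod A B
  | true => (inl : A →* Coprod A B).comp (MulEquiv.ulift : ULift.{v} A ≃* A).toMonoidHom
  | false => (inr : B →* Coprod A B).comp (MulEquiv.ulift : ULift.{u} B ≃* B).toMonoidHom

variable (A B) in
/-- The binary free product as an indexed free product. -/
def equivCoprodI : Coprod A B ≃* CoprodI (BoolFamily A B) :=
  MonoidHom.toMulEquiv (lift (inlBool A B) (inrBool A B)) (CoprodI.lift (ofBool A B))
    (hom_ext
      (MonoidHom.ext fun a =>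
        CoprodI.lift_of (ofBool A B) (i := true) (ULift.up a : ULift.{v} A))
      (MonoidHom.ext fun b =>
        CoprodI.lift_of (ofBool A B) (i := false) (ULift.up b : ULift.{u} B)))
    (CoprodI.ext_hom _ _ fun i => MonoidHom.ext fun a => by
      simp only [MonoidHom.comp_apply, CoprodI.lift_of, MonoidHom.id_apply]
      cases i <;> rfl)

theorem isElliptic_iff (x : Coprod A B) :
    IsElliptic x ↔ ∃ (c : CoprodI (BoolFamily A B)) (k : Bool) (a : BoolFamily A B k),
      equivCoprodI A B x = c * CoprodI.of a * c⁻¹ := by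
  constructor
  · rintro ⟨c, ⟨a, rfl⟩ | ⟨b, rfl⟩⟩
    · exact ⟨equivCoprodI A B c, true, (ULift.up a : ULift.{v} A), by
        rw [map_mul, map_mul, map_inv]; rfl⟩
    · exact ⟨equivCoprodI A B c, false, (ULift.up b : ULift.{u} B), by
        rw [map_mul, map_mul, map_inv]; rfl⟩
  · rintro ⟨c, k, a, h⟩
    have hconj : x = (equivCoprodI A B).symm c * ofBool A B k a * ((equivCoprodI A B).symm c)⁻¹ := by
      rw [← (equivCoprodI A B).symm_apply_apply x, h, map_mul, map_mul, map_inv]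
      congr 2
    refine ⟨(equivCoprodI A B).symm c, ?_⟩
    cases k with
    | true => exact .inl ⟨ULift.down (α := A) a, hconj⟩
    | false => exact .inr ⟨ULift.down (α := B) a, hconj⟩

/-- A nontrivial element commuting with a non-elliptic element is not elliptic. -/
theorem not_isElliptic_of_commute {x y : Coprod A B} (hy : y ≠ 1) (hxy : Commute x y)
    (hx : ¬ IsElliptic x) : ¬ IsElliptic y := by
  rw [isElliptic_iff] at hx ⊢
  rintro ⟨c, k, a, h⟩
  obtain ⟨b, hb⟩ := CoprodI.exists_eq_conj_of_of_commute
    (h ▸ (map_ne_one_iff _ (equivCoprodI A B).injective).2 hy)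
    (h ▸ hxy.map (equivCoprodI A B))
  exact hx ⟨c, k, b, hb⟩

end Monoid.Coprod

/-- Commutation transitivity for non-elliptic elements of a free product: if `x, y, z` are
nontrivial, `x` commutes with `y` and with `z`, and `x` is not elliptic, then `y` and `z` are
not elliptic and they commute. -/
theorem commute_of_commute_with_nonelliptic {A B : Type*} [Group A] [Group B]
    (x y z : Monoid.Coprod A B) (hx : x ≠ 1) (hy : y ≠ 1) (hz : z ≠ 1)
    (hxy : Commute x y) (hxz : Commute x z) (hxe : ¬ IsElliptic x) :
    ¬ IsElliptic y ∧ ¬ IsElliptic z ∧ Commute y z := by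
  refine ⟨Monoid.Coprod.not_isElliptic_of_commute hy hxy hxe,
    Monoid.Coprod.not_isElliptic_of_commute hz hxz hxe, ?_⟩
  let e := Monoid.Coprod.equivCoprodI A B
  have h : Commute (e y) (e z) := Monoid.CoprodI.commute_of_commute_of_forall_ne_conj
    (fun c k a h => hxe ((Monoid.Coprod.isElliptic_iff x).2 ⟨c, k, a, h⟩))
    ((map_ne_one_iff _ e.injective).2 hx) (hxy.map e) (hxz.map e)
  exact e.injective (by simpa only [map_mul] using h.eq)
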